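/- arXiv:1804.11098 — 2 statements merged into one kernel-verified Lean document; each statement's English description precedes it below -/
import Mathlib

section
/- Let γ : ℝ/(Lℤ) → ℝ³ be a smooth simple closed arc-length parametrized curve. Fix s₁ and put, for small t > 0, ψ(t) = ∫ over points x₂ on the curve within distance t (in ℝ³) of x₁ = γ(s₁) of γ'(s₁)·(unit tangent at x₂) with respect to arc length. Then ψ(t) = 2t - (κ²/4) t³ + O(t⁵) as t → 0⁺, where κ is the curvature at s₁; in particular φ(t) := ψ'(t) satisfies φ(t) = 2 - (3κ²/4) t² + O(t⁴). -/
open MeasureTheory Filter Topology Asymptotics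

open scoped RealInnerProductSpace

section Calculus

variable {E : Type*} [NormedAddCommGroup E] [NormedSpace ℝ E]

theorem hasDerivAt_integral_smul_comp_mul {w : ℝ → ℝ} {φ : ℝ → E} (hw : Continuous w)
    (hφ : ContDiff ℝ 1 φ) (x : ℝ) :
    HasDerivAt (fun x => ∫ u in (0 : ℝ)..1, w u • φ (x * u))
      (∫ u in (0 : ℝ)..1, (w u * u) • deriv φ (x * u)) x := by
  have hφc := hφ.continuous
  have hdc : Continuous (deriv φ) := hφ.continuous_deriv le_rfl
  obtain ⟨C, hC⟩ := ((isCompact_closedBall x 1).prod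
    (isCompact_Icc (a := (0 : ℝ)) (b := 1))).exists_bound_of_continuousOn
    (f := fun p : ℝ × ℝ => (w p.2 * p.2) • deriv φ (p.1 * p.2)) (by fun_prop)
  refine (intervalIntegral.hasDerivAt_integral_of_dominated_loc_of_deriv_le
    (F := fun x u => w u • φ (x * u)) (F' := fun x u => (w u * u) • deriv φ (x * u))
    (bound := fun _ => C) (Metric.ball_mem_nhds x one_pos) (.of_forall fun y => ?_) ?_ ?_
    (.of_forall fun u hu y hy => ?_) (by simp) (.of_forall fun u _ y _ => ?_)).2
  · exact (by fun_prop : Continuous fun u => w u • φ (y * u)).aestronglyMeasurable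
  · exact (by fun_prop : Continuous fun u => w u • φ (x * u)).intervalIntegrable _ _
  · exact (by fun_prop : Continuous fun u => (w u * u) • deriv φ (x * u)).aestronglyMeasurable
  · rw [Set.uIoc_of_le zero_le_one] at hu
    exact hC (y, u) ⟨Metric.ball_subset_closedBall hy, hu.1.le, hu.2⟩
  · have h := (hφ.differentiable one_ne_zero (y * u)).hasDerivAt.scomp y
      ((hasDerivAt_id y).mul_const u)
    simpa [mul_smul] using! h.const_smul (w u)

theorem contDiff_integral_smul_comp_mul (n : ℕ) : ∀ {w : ℝ → ℝ} {φ : ℝ → E}, Continuous w →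
    ContDiff ℝ n φ → ContDiff ℝ n (fun x => ∫ u in (0 : ℝ)..1, w u • φ (x * u)) := by
  induction n with
  | zero =>
    intro w φ hw hφ
    have hφc := hφ.continuous
    exact contDiff_zero.2
      (intervalIntegral.continuous_parametric_intervalIntegral_of_continuous' (by fun_prop) 0 1)
  | succ n ih =>
    intro w φ hw hφ
    have hφ1 : ContDiff ℝ 1 φ := hφ.of_le (by norm_cast; omega)
    have hd := hasDerivAt_integral_smul_comp_mul hw hφ1
    push_cast at hφ ⊢
    rw [contDiff_succ_iff_deriv] at hφ ⊢
    refine ⟨fun x => (hd x).differentiableAt, by simp, ?_⟩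
    rw [show deriv (fun x => ∫ u in (0 : ℝ)..1, w u • φ (x * u)) = _ from
      funext fun x => (hd x).deriv]
    exact ih (by fun_prop) hφ.2.2

/-- Hadamard's lemma for curves. -/
theorem exists_contDiff_eq_smul [CompleteSpace E] {G : ℝ → E} (n : ℕ)
    (hG : ContDiff ℝ (n + 1) G) (h0 : G 0 = 0) :
    ∃ h : ℝ → E, ContDiff ℝ n h ∧ h 0 = deriv G 0 ∧ ∀ s, G s = s • h s := by
  have hd := (contDiff_succ_iff_deriv.1 hG)
  refine ⟨fun x => ∫ u in (0 : ℝ)..1, (1 : ℝ) • deriv G (x * u),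
    contDiff_integral_smul_comp_mul n continuous_const hd.2.2, by simp, fun s => ?_⟩
  have hc : Continuous (deriv G) := hd.2.2.continuous
  simp only [one_smul]
  rw [intervalIntegral.smul_integral_comp_mul_left, mul_zero, mul_one,
    intervalIntegral.integral_deriv_eq_sub (fun x _ => hd.1 x) (hc.intervalIntegrable _ _), h0,
    sub_zero]

theorem isBigO_sub_of_deriv_isBigO {f : ℝ → E} {n : ℕ}
    (hf : ∀ᶠ x in 𝓝 0, DifferentiableAt ℝ f x) (hd : deriv f =O[𝓝 0] fun x => x ^ n) :
    (fun x => f x - f 0) =O[𝓝 0] fun x : ℝ => x ^ (n + 1) := by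
  obtain ⟨C, hC⟩ := hd.bound
  obtain ⟨ε, hε, hball⟩ := Metric.eventually_nhds_iff_ball.1 (hf.and hC)
  refine .of_bound C (Metric.eventually_nhds_iff_ball.2 ⟨ε, hε, fun x hx => ?_⟩)
  have hC0 : 0 ≤ C * ‖x ^ n‖ := (norm_nonneg _).trans (hball x hx).2
  have hsub : ∀ y ∈ Set.uIcc 0 x, |y| ≤ |x| := fun y hy => by
    simpa using Set.abs_sub_left_of_mem_uIcc hy
  have hmem : ∀ y ∈ Set.uIcc 0 x, y ∈ Metric.ball (0 : ℝ) ε := fun y hy => by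
    simp only [Metric.mem_ball, dist_zero_right, Real.norm_eq_abs] at hx ⊢
    exact (hsub y hy).trans_lt hx
  have h := (convex_uIcc 0 x).norm_image_sub_le_of_norm_deriv_le (f := f) (C := C * ‖x ^ n‖)
    (fun y hy => (hball y (hmem y hy)).1) (fun y hy => ?_) Set.left_mem_uIcc Set.right_mem_uIcc
  · simpa [pow_succ, mul_assoc] using h
  · by_cases hx0 : x = 0
    · subst hx0
      obtain rfl : y = 0 := by simpa using hy
      exact (hball 0 hx).2
    · refine (hball y (hmem y hy)).2.trans ?_
      have hC1 : 0 ≤ C := nonneg_of_mul_nonneg_left hC0 (norm_pos_iff.2 (pow_ne_zero n hx0))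
      rw [norm_pow, norm_pow]
      gcongr
      exact hsub y hy

/-- Taylor's theorem at the origin, with a big-O remainder. -/
theorem taylor_isBigO_zero (n : ℕ) : ∀ {f : ℝ → E}, ContDiffAt ℝ n f 0 →
    (fun x => f x - ∑ k ∈ Finset.range n, (x ^ k / (k.factorial : ℝ)) • iteratedDeriv k f 0)
      =O[𝓝 0] fun x : ℝ => x ^ n := by
  induction n with
  | zero =>
    intro f hf
    simpa using hf.continuousAt.norm.isBoundedUnder_le.isBigO_one ℝ
  | succ n ih =>
    intro f hf
    have hd : ContDiffAt ℝ n (deriv f) 0 := hf.derivWithin (by norm_cast)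
    have hdiff : ∀ᶠ x in 𝓝 0, DifferentiableAt ℝ f x :=
      ((hf.of_le (m := 1) (by norm_cast; omega)).eventually (by simp)).mono fun x hx =>
        hx.differentiableAt one_ne_zero
    have hsum : ∀ x : ℝ, HasDerivAt
        (fun x : ℝ => ∑ k ∈ Finset.range (n + 1),
          (x ^ k / (k.factorial : ℝ)) • iteratedDeriv k f 0)
        (∑ k ∈ Finset.range n, (x ^ k / (k.factorial : ℝ)) • iteratedDeriv k (deriv f) 0) x := by
      intro x
      simp only [Finset.sum_range_succ' _ n]
      simp only [pow_zero, Nat.factorial_zero, Nat.cast_one, div_one, one_smul]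
      refine HasDerivAt.add_const _ (.fun_sum fun k _ => ?_)
      rw [iteratedDeriv_succ']
      refine HasDerivAt.smul_const ?_ _
      convert (hasDerivAt_pow (k + 1) x).div_const ((k + 1).factorial : ℝ) using 1
      rw [Nat.factorial_succ]
      push_cast
      field_simp
    have h := isBigO_sub_of_deriv_isBigO (n := n) (f := fun x => f x -
      ∑ k ∈ Finset.range (n + 1), (x ^ k / (k.factorial : ℝ)) • iteratedDeriv k f 0)
      (hdiff.mono fun x hx => hx.sub (hsum x).differentiableAt) ?_
    · simpa [Finset.sum_range_succ' _ n] using h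
    · refine (ih hd).congr' (hdiff.mono fun x hx => ?_) .rfl
      exact (hx.hasDerivAt.sub (hsum x)).deriv.symm

end Calculus

theorem eq_zero_and_isLittleO_of_add_mul_isLittleO {b : ℝ} {g : ℝ → ℝ} {n : ℕ}
    (hg : ContinuousAt g 0) (h : (fun x => b + x * g x) =o[𝓝[≠] 0] fun x : ℝ => x ^ (n + 1)) :
    b = 0 ∧ g =o[𝓝[≠] 0] fun x : ℝ => x ^ n := by
  have hb : b = 0 := by
    have h1 : Tendsto (fun x => b + x * g x) (𝓝[≠] 0) (𝓝 0) :=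
      h.trans_tendsto (((continuous_pow (n + 1)).tendsto' 0 0 (by simp)).mono_left
        nhdsWithin_le_nhds)
    have h2 : Tendsto (fun x => b + x * g x) (𝓝[≠] 0) (𝓝 (b + 0 * g 0)) :=
      (tendsto_const_nhds.add (tendsto_id.mul hg)).mono_left nhdsWithin_le_nhds
    simpa using tendsto_nhds_unique h2 h1
  refine ⟨hb, ?_⟩
  have h3 := (isBigO_refl (fun x : ℝ => x⁻¹) (𝓝[≠] 0)).mul_isLittleO h
  refine h3.congr' ?_ ?_ <;> filter_upwards [self_mem_nhdsWithin] with x hx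
  · have : x ≠ 0 := hx
    field_simp
    simp [hb]
  · have : x ≠ 0 := hx
    field_simp
    ring

theorem coeffs_eq_zero_of_isLittleO {b₀ b₁ b₂ b₃ : ℝ}
    (h : (fun x => b₀ + b₁ * x + b₂ * x ^ 2 + b₃ * x ^ 3) =o[𝓝[≠] 0] fun x : ℝ => x ^ 3) :
    b₀ = 0 ∧ b₁ = 0 ∧ b₂ = 0 ∧ b₃ = 0 := by
  obtain ⟨h₀, h⟩ := eq_zero_and_isLittleO_of_add_mul_isLittleO (n := 2) (b := b₀)
    (g := fun x => b₁ + x * (b₂ + x * b₃)) (by fun_prop)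
    (h.congr_left fun x => by ring)
  obtain ⟨h₁, h⟩ := eq_zero_and_isLittleO_of_add_mul_isLittleO (n := 1) (by fun_prop) h
  obtain ⟨h₂, h⟩ := eq_zero_and_isLittleO_of_add_mul_isLittleO (n := 0) (by fun_prop) h
  refine ⟨h₀, h₁, h₂, ?_⟩
  simpa using h

/-- The odd part of a smooth function inherits its third order expansion with improved errors. -/
theorem odd_part_isBigO {F : ℝ → ℝ} {c : ℝ} (hF : ContDiffAt ℝ 5 F 0)
    (hc : (fun x => F x - (x - c * x ^ 3)) =o[𝓝[≠] 0] fun x : ℝ => x ^ 3) :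
    ((fun x => F x - F (-x) - (2 * x - 2 * c * x ^ 3)) =O[𝓝 0] fun x : ℝ => x ^ 5) ∧
    ((fun x => deriv (fun y => F y - F (-y)) x - (2 - 6 * c * x ^ 2))
      =O[𝓝 0] fun x : ℝ => x ^ 4) := by
  have h4 := taylor_isBigO_zero 4 (hF.of_le (by norm_num))
  have h5 := taylor_isBigO_zero 5 hF
  have h4d := taylor_isBigO_zero 4 (f := deriv F) (hF.derivWithin (by norm_num))
  simp only [← iteratedDeriv_succ', Finset.sum_range_succ, Finset.sum_range_zero,
    Nat.factorial, smul_eq_mul] at h4 h5 h4d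
  norm_num at h4 h5 h4d
  have hlt : (fun x : ℝ => x ^ 4) =o[𝓝[≠] 0] fun x : ℝ => x ^ 3 :=
    (isLittleO_pow_pow (by norm_num)).mono nhdsWithin_le_nhds
  obtain ⟨-, h1, -, h3⟩ := coeffs_eq_zero_of_isLittleO (b₀ := F 0) (b₁ := deriv F 0 - 1)
    (b₂ := iteratedDeriv 2 F 0 / 2) (b₃ := iteratedDeriv 3 F 0 / 6 + c)
    ((hc.sub ((h4.mono nhdsWithin_le_nhds).trans_isLittleO hlt)).congr_left fun x => by ring)
  have hneg : Tendsto (fun x : ℝ => -x) (𝓝 0) (𝓝 0) := continuous_neg.tendsto' 0 0 (by simp)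
  have hd1 : deriv F 0 = 1 := by linarith
  have hd3 : iteratedDeriv 3 F 0 = -6 * c := by linarith
  constructor
  · have h5n := (h5.comp_tendsto hneg).trans
      (IsBigO.of_bound 1 (by simp) : _ =O[𝓝 0] fun x : ℝ => x ^ 5)
    refine (h5.sub h5n).congr_left fun x => ?_
    simp only [Function.comp_apply, hd1, hd3]
    ring
  · have h4n := (h4d.comp_tendsto hneg).trans
      (IsBigO.of_bound 1 (by simp) : _ =O[𝓝 0] fun x : ℝ => x ^ 4)
    have hdiff : ∀ᶠ x in 𝓝 0, DifferentiableAt ℝ F x :=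
      (hF.eventually (by simp)).mono fun x hx => hx.differentiableAt (by norm_num)
    refine (h4d.add h4n).congr' ?_ .rfl
    filter_upwards [hdiff, hneg.eventually hdiff] with x hx hx'
    have : HasDerivAt (fun y => F y - F (-y)) (deriv F x - -deriv F (-x)) x := by
      simpa using! hx.hasDerivAt.sub (hx'.hasDerivAt.scomp x (hasDerivAt_neg x))
    rw [this.deriv]
    simp only [Function.comp_apply, hd1, hd3]
    ring

section Curve

variable {E : Type*} [NormedAddCommGroup E] [InnerProductSpace ℝ E]

theorem inner_deriv_two_and_three_of_norm_deriv_eq_one {G : ℝ → E} (hG : ContDiff ℝ 3 G)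
    (harc : ∀ s, ‖deriv G s‖ = 1) (s : ℝ) :
    ⟪deriv G s, iteratedDeriv 2 G s⟫ = 0 ∧
      ⟪deriv G s, iteratedDeriv 3 G s⟫ = -‖iteratedDeriv 2 G s‖ ^ 2 := by
  have hd1 : ∀ s, HasDerivAt (deriv G) (iteratedDeriv 2 G s) s := fun s => by
    have := hG.differentiable_iteratedDeriv 1 (by norm_num) s
    simpa [iteratedDeriv_succ] using this.hasDerivAt
  have hd2 : ∀ s, HasDerivAt (iteratedDeriv 2 G) (iteratedDeriv 3 G s) s := fun s => by
    rw [iteratedDeriv_succ (n := 2)]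
    exact (hG.differentiable_iteratedDeriv 2 (by norm_num) s).hasDerivAt
  have h1 : ∀ s, ⟪deriv G s, iteratedDeriv 2 G s⟫ = 0 := fun s => by
    have h := (hd1 s).inner ℝ (hd1 s)
    have hconst : (fun s => ⟪deriv G s, deriv G s⟫) = fun _ => (1 : ℝ) :=
      funext fun s => by rw [real_inner_self_eq_norm_sq, harc, one_pow]
    rw [hconst, real_inner_comm] at h
    have := h.unique (hasDerivAt_const s (1 : ℝ))
    rw [real_inner_comm (deriv G s)] at this
    linarith [real_inner_comm (deriv G s) (iteratedDeriv 2 G s)]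
  refine ⟨h1 s, ?_⟩
  have h := (hd1 s).inner ℝ (hd2 s)
  rw [show (fun s => ⟪deriv G s, iteratedDeriv 2 G s⟫) = fun _ => (0 : ℝ) from funext h1] at h
  have := h.unique (hasDerivAt_const s (0 : ℝ))
  rw [real_inner_self_eq_norm_sq] at this
  linarith

/-- Second order expansions of the chord direction `h s = G s / s` of a unit speed curve. -/
theorem tendsto_chord_direction {G h : ℝ → E} (hG : ContDiff ℝ 4 G)
    (harc : ∀ s, ‖deriv G s‖ = 1) (hGh : ∀ s, G s = s • h s) (hh : ContinuousAt h 0)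
    (hh0 : h 0 = deriv G 0) :
    Tendsto (fun s => (⟪deriv G 0, h s⟫ - 1) / s ^ 2) (𝓝[≠] 0)
        (𝓝 (-‖iteratedDeriv 2 G 0‖ ^ 2 / 6)) ∧
      Tendsto (fun s => (‖h s‖ - 1) / s ^ 2) (𝓝[≠] 0)
        (𝓝 (-‖iteratedDeriv 2 G 0‖ ^ 2 / 24)) := by
  obtain ⟨hTA, hTB⟩ := inner_deriv_two_and_three_of_norm_deriv_eq_one
    (hG.of_le (by norm_num)) harc 0
  set T := deriv G 0
  set A := iteratedDeriv 2 G 0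
  set B := iteratedDeriv 3 G 0
  have hTT : ⟪T, T⟫ = 1 := by rw [real_inner_self_eq_norm_sq, harc, one_pow]
  have hG0 : G 0 = 0 := by simpa using hGh 0
  obtain ⟨k, hk⟩ : ∃ k : ℝ → E, ∀ s, s ≠ 0 → h s = T + (s / 2) • A + s ^ 2 • k s :=
    ⟨fun s => (s ^ 2)⁻¹ • (h s - T - (s / 2) • A), fun s hs => by
      rw [smul_inv_smul₀ (pow_ne_zero 2 hs)]; abel⟩
  have hklim : Tendsto k (𝓝[≠] 0) (𝓝 ((1 / 6 : ℝ) • B)) := by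
    have h4 := taylor_isBigO_zero 4 hG.contDiffAt
    simp only [Finset.sum_range_succ, Finset.sum_range_zero, Nat.factorial] at h4
    norm_num [hG0] at h4
    have hlt : (fun x : ℝ => x ^ 4) =o[𝓝[≠] 0] fun x : ℝ => x ^ 3 :=
      (isLittleO_pow_pow (by norm_num)).mono nhdsWithin_le_nhds
    have h3 := (isBigO_refl (fun x : ℝ => (x ^ 3)⁻¹) (𝓝[≠] 0)).smul_isLittleO
      ((h4.mono nhdsWithin_le_nhds).trans_isLittleO hlt)
    rw [tendsto_iff_norm_sub_tendsto_zero, ← tendsto_zero_iff_norm_tendsto_zero,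
      ← isLittleO_one_iff ℝ]
    refine h3.congr' ?_ ?_ <;> filter_upwards [self_mem_nhdsWithin] with s hs
    · have hs0 : s ≠ 0 := hs
      rw [inv_smul_eq_iff₀ (pow_ne_zero 3 hs0), hGh s, hk s hs0]
      module
    · have hs0 : s ≠ 0 := hs
      simp [hs0]
  have hid : Tendsto (fun s : ℝ => s) (𝓝[≠] 0) (𝓝 0) := tendsto_id.mono_left nhdsWithin_le_nhds
  have hTk : Tendsto (fun s => ⟪T, k s⟫) (𝓝[≠] 0) (𝓝 (-‖A‖ ^ 2 / 6)) := by
    convert tendsto_const_nhds.inner hklim using 2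
    rw [real_inner_smul_right, hTB]
    ring
  refine ⟨hTk.congr' ?_, ?_⟩
  · filter_upwards [self_mem_nhdsWithin] with s hs
    have hs0 : s ≠ 0 := hs
    rw [hk s hs0, inner_add_right, inner_add_right, real_inner_smul_right, real_inner_smul_right,
      hTT, hTA]
    field_simp
    ring
  · have hden : Tendsto (fun s => ‖h s‖ + 1) (𝓝[≠] 0) (𝓝 2) := by
      have := (hh.norm.add_const 1).tendsto.mono_left (nhdsWithin_le_nhds (s := {0}ᶜ))
      rw [hh0, harc] at this
      norm_num at this
      exact this
    have hnum : Tendsto (fun s => ‖A‖ ^ 2 / 4 + 2 * ⟪T, k s⟫ + s * ⟪A, k s⟫ + s ^ 2 * ‖k s‖ ^ 2)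
        (𝓝[≠] 0) (𝓝 (-‖A‖ ^ 2 / 12)) := by
      convert (((hTk.const_mul 2).const_add (‖A‖ ^ 2 / 4)).add
        (hid.mul (tendsto_const_nhds.inner hklim))).add ((hid.pow 2).mul (hklim.norm.pow 2)) using 2
      ring
    have hquot := hnum.div hden two_ne_zero
    rw [show -‖A‖ ^ 2 / 12 / 2 = -‖A‖ ^ 2 / 24 by ring] at hquot
    refine hquot.congr' ?_
    filter_upwards [self_mem_nhdsWithin] with s hs
    have hs0 : s ≠ 0 := hs
    have hpos : ‖h s‖ + 1 ≠ 0 := by positivity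
    have hsq : ‖h s‖ ^ 2 = 1 + s ^ 2 *
        (‖A‖ ^ 2 / 4 + 2 * ⟪T, k s⟫ + s * ⟪A, k s⟫ + s ^ 2 * ‖k s‖ ^ 2) := by
      rw [hk s hs0, ← real_inner_self_eq_norm_sq, ← real_inner_self_eq_norm_sq,
        ← real_inner_self_eq_norm_sq]
      simp only [inner_add_left, inner_add_right, real_inner_smul_left, real_inner_smul_right, hTT,
        hTA, real_inner_comm T A, real_inner_comm T (k s), real_inner_comm A (k s)]
      ring_nf
    simp only [Pi.div_apply]
    rw [div_eq_div_iff hpos (pow_ne_zero 2 hs0)]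
    linear_combination -hsq

/-- The signed distance `s * ‖h s‖` from the base point of a unit speed curve has a smooth local
inverse `σ`, in terms of which small balls around the base point cut out intervals. -/
theorem exists_inverse_signed_distance {h : ℝ → E} (hh : ContDiff ℝ 5 h) (hh0 : ‖h 0‖ = 1) :
    ∃ σ : ℝ → ℝ, ContDiffAt ℝ 5 σ 0 ∧ σ 0 = 0 ∧ (∀ᶠ x in 𝓝 0, σ x * ‖h (σ x)‖ = x) ∧
      ∃ δ > 0, StrictMonoOn (fun s => s * ‖h s‖) (Set.Ioo (-δ) δ) := by
  have hne : h 0 ≠ 0 := by rw [← norm_ne_zero_iff, hh0]; exact one_ne_zero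
  have hρ : ContDiffAt ℝ 5 (fun s => s * ‖h s‖) 0 :=
    contDiffAt_id.mul (hh.contDiffAt.norm ℝ hne)
  have hρ' : HasDerivAt (fun s => s * ‖h s‖) 1 0 := by
    have hn : DifferentiableAt ℝ (fun s => ‖h s‖) 0 :=
      (hh.contDiffAt.norm ℝ hne).differentiableAt (by norm_num)
    simpa [hh0] using! (hasDerivAt_id (0 : ℝ)).mul hn.hasDerivAt
  have hF := hρ'.hasFDerivAt_equiv one_ne_zero
  have hcont : ContinuousAt (deriv fun s => s * ‖h s‖) 0 :=
    (hρ.derivWithin (m := 4) (by norm_num)).continuousAt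
  have hpos : ∀ᶠ s in 𝓝 0, 0 < deriv (fun s => s * ‖h s‖) s :=
    hcont.eventually (lt_mem_nhds (by rw [hρ'.deriv]; exact one_pos))
  obtain ⟨δ, hδ, hball⟩ := Metric.eventually_nhds_iff_ball.1 hpos
  rw [Real.ball_eq_Ioo, zero_sub, zero_add] at hball
  refine ⟨hρ.localInverse hF (by norm_num), ?_, ?_, ?_, δ, hδ, ?_⟩
  · simpa using hρ.to_localInverse hF (by norm_num)
  · simpa using hρ.localInverse_apply_image hF (by norm_num)
  · have := (hρ.hasStrictFDerivAt' hF (by norm_num)).eventually_right_inverse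
    rw [zero_mul] at this
    exact this
  · refine strictMonoOn_of_deriv_pos (convex_Ioo _ _) (fun s _ => ?_) fun s hs => ?_
    · have := hh.continuous
      exact (by fun_prop : Continuous fun s => s * ‖h s‖).continuousWithinAt
    · rw [interior_Ioo] at hs
      exact hball s hs

theorem sublevel_norm_eventually_eq_Icc {G h : ℝ → E} {σ : ℝ → ℝ} {δ l : ℝ} (hG : Continuous G)
    (hl : 0 < l) (hne : ∀ s ∈ Set.Icc (-l) l, s ≠ 0 → G s ≠ 0) (hGh : ∀ s, G s = s • h s)
    (hσ : ContinuousAt σ 0) (hσ0 : σ 0 = 0) (hinv : ∀ᶠ x in 𝓝 0, σ x * ‖h (σ x)‖ = x)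
    (hδ : 0 < δ) (hmono : StrictMonoOn (fun s => s * ‖h s‖) (Set.Ioo (-δ) δ)) :
    ∀ᶠ t in 𝓝[>] (0 : ℝ), σ (-t) ≤ σ t ∧
      {s | s ∈ Set.Ioc (-l) l ∧ ‖G s‖ ≤ t} = Set.Icc (σ (-t)) (σ t) := by
  obtain ⟨c, hc, hfar⟩ := (isCompact_Icc.diff (isOpen_Ioo (a := -δ) (b := δ))
    : IsCompact (Set.Icc (-l) l \ Set.Ioo (-δ) δ)).exists_forall_le' (f := fun s => ‖G s‖)
    (a := 0) (by fun_prop) fun s hs => norm_pos_iff.2 <| hne s hs.1 fun h0 => hs.2 <| by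
      subst h0; exact ⟨by linarith, hδ⟩
  have hsmall : ∀ᶠ x in 𝓝 0, σ x ∈ Set.Ioo (-δ) δ ∧ σ x ∈ Set.Ioo (-l) l := by
    have hσ' : Tendsto σ (𝓝 0) (𝓝 0) := by simpa [ContinuousAt, hσ0] using hσ
    exact hσ'.eventually ((eventually_mem_set.2 (Ioo_mem_nhds (neg_lt_zero.2 hδ) hδ)).and
      (eventually_mem_set.2 (Ioo_mem_nhds (neg_lt_zero.2 hl) hl)))
  have hneg : Tendsto (fun x : ℝ => -x) (𝓝 0) (𝓝 0) := continuous_neg.tendsto' 0 0 (by simp)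
  filter_upwards [nhdsWithin_le_nhds (hsmall.and hinv),
    nhdsWithin_le_nhds (hneg.eventually (hsmall.and hinv)),
    nhdsWithin_le_nhds (gt_mem_nhds hc), self_mem_nhdsWithin]
    with t ⟨⟨htδ, htl⟩, ht⟩ ⟨⟨htδ', htl'⟩, ht'⟩ htc (htpos : 0 < t)
  have hle : ∀ s ∈ Set.Ioo (-δ) δ, ‖G s‖ ≤ t ↔ s ∈ Set.Icc (σ (-t)) (σ t) := fun s hs => by
    have h1 := hmono.le_iff_le htδ' hs
    have h2 := hmono.le_iff_le hs htδ
    simp only [ht, ht'] at h1 h2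
    rw [Set.mem_Icc, ← h1, ← h2, hGh, norm_smul, Real.norm_eq_abs, ← abs_norm (h s), ← abs_mul,
      abs_le, abs_norm]
  refine ⟨(hmono.le_iff_le htδ' htδ).1 (by simp only [ht, ht']; linarith), Set.ext fun s => ?_⟩
  constructor
  · rintro ⟨hsl, hst⟩
    refine (hle s (by_contra fun hs => ?_)).1 hst
    exact absurd (hfar s ⟨Set.Ioc_subset_Icc_self hsl, hs⟩) (by simp only [not_le]; linarith)
  · intro hs
    exact ⟨⟨htl'.1.trans_le hs.1, hs.2.trans htl.2.le⟩,
      (hle s ⟨htδ'.1.trans_le hs.1, hs.2.trans_lt htδ.2⟩).2 hs⟩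

/-- The tangential coordinate as a function of the signed distance. -/
theorem tangential_coordinate_isLittleO {G h : ℝ → E} {σ : ℝ → ℝ} (hG : ContDiff ℝ 4 G)
    (harc : ∀ s, ‖deriv G s‖ = 1) (hGh : ∀ s, G s = s • h s) (hh : ContinuousAt h 0)
    (hh0 : h 0 = deriv G 0) (hσ : ContinuousAt σ 0) (hσ0 : σ 0 = 0)
    (hinv : ∀ᶠ x in 𝓝 0, σ x * ‖h (σ x)‖ = x) :
    (fun x => ⟪deriv G 0, G (σ x)⟫ - (x - ‖iteratedDeriv 2 G 0‖ ^ 2 / 8 * x ^ 3))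
      =o[𝓝[≠] 0] fun x : ℝ => x ^ 3 := by
  obtain ⟨h1, h2⟩ := tendsto_chord_direction hG harc hGh hh hh0
  set κ := ‖iteratedDeriv 2 G 0‖
  have hq : Tendsto (fun s => ‖h s‖) (𝓝[≠] 0) (𝓝 1) := by
    have := hh.norm.tendsto.mono_left (nhdsWithin_le_nhds (s := {0}ᶜ))
    rwa [hh0, harc] at this
  have hlim := ((h1.sub h2).div (hq.pow 3) (by norm_num)).add_const (κ ^ 2 / 8)
  rw [show (-κ ^ 2 / 6 - -κ ^ 2 / 24) / 1 ^ 3 + κ ^ 2 / 8 = 0 by ring] at hlim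
  have hσ' : Tendsto σ (𝓝[≠] 0) (𝓝[≠] 0) := by
    refine tendsto_nhdsWithin_iff.2 ⟨?_, ?_⟩
    · simpa [ContinuousAt, hσ0] using hσ.tendsto.mono_left (nhdsWithin_le_nhds (s := {0}ᶜ))
    · filter_upwards [nhdsWithin_le_nhds hinv, self_mem_nhdsWithin] with x hx hx0 h0
      rw [Set.mem_singleton_iff] at h0
      rw [h0, zero_mul] at hx
      exact hx0 hx.symm
  rw [isLittleO_iff_tendsto' (by
    filter_upwards [self_mem_nhdsWithin] with x hx h0
    exact absurd h0 (pow_ne_zero 3 hx))]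
  refine (hlim.comp hσ').congr' ?_
  filter_upwards [nhdsWithin_le_nhds hinv, self_mem_nhdsWithin] with x hx (hx0 : x ≠ 0)
  have hs0 : σ x ≠ 0 := fun h0 => hx0 (by rw [← hx, h0, zero_mul])
  have hq0 : ‖h (σ x)‖ ≠ 0 := fun h0 => hx0 (by rw [← hx, h0, mul_zero])
  simp only [Function.comp_apply, Pi.div_apply]
  rw [hGh (σ x), real_inner_smul_right]
  generalize ⟪deriv G 0, h (σ x)⟫ = f at *
  generalize ‖h (σ x)‖ = q at *
  generalize σ x = s at *
  subst hx
  field_simp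
  ring

end Curve

theorem ne_of_injOn_Ico_of_periodic {α : Type*} {γ : ℝ → α} {L : ℝ} (hL : 0 < L)
    (hper : ∀ s, γ (s + L) = γ s) (hsimple : Set.InjOn γ (Set.Ico 0 L)) {a s : ℝ}
    (hs : s ∈ Set.Icc (-(L / 2)) (L / 2)) (hs0 : s ≠ 0) : γ (a + s) ≠ γ a := by
  intro heq
  have hp : Function.Periodic γ L := hper
  have hmod : ∀ x, γ (toIcoMod hL 0 x) = γ x := fun x => by
    rw [toIcoMod, hp.sub_zsmul_eq]
  have h := hsimple (by simpa using toIcoMod_mem_Ico hL 0 (a + s))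
    (by simpa using toIcoMod_mem_Ico hL 0 a) (by rw [hmod, hmod, heq])
  obtain ⟨n, hn⟩ := (toIcoMod_eq_toIcoMod hL).1 h
  rw [sub_add_cancel_left, zsmul_eq_mul] at hn
  have habs : |(n : ℝ)| * L = |s| := by rw [← abs_neg s, hn, abs_mul, abs_of_pos hL]
  have hn0 : n ≠ 0 := by
    rintro rfl
    simp at hn
    exact hs0 hn
  have h1 : (1 : ℝ) ≤ |(n : ℝ)| := by exact_mod_cast Int.one_le_abs hn0
  have h2 : |s| ≤ L / 2 := abs_le.2 hs
  nlinarith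

/-- For a smooth simple closed arc-length parametrized curve `γ` of length `L`,
fixing `s₁` and setting
`ψ(t) = ∫_{x₂ ∈ Γ, |x₂ - x₁| ≤ t} γ'(s₁)·t_{x₂} dx₂` (arc-length integral over the
points of the loop within chord distance `t` of `x₁ = γ(s₁)`), one has
`ψ(t) = 2t - (κ²/4)t³ + O(t⁵)` and `ψ'(t) = 2 - (3κ²/4)t² + O(t⁴)` as `t → 0⁺`,
where `κ` is the curvature at `s₁`. -/
theorem stmt9 (L : ℝ) (hL : 0 < L) (γ : ℝ → EuclideanSpace ℝ (Fin 3))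
    (hγ : ContDiff ℝ (⊤ : ℕ∞) γ) (hper : ∀ s, γ (s + L) = γ s)
    (harc : ∀ s, ‖deriv γ s‖ = 1) (hsimple : Set.InjOn γ (Set.Ico 0 L))
    (s₁ κ : ℝ) (hκ : κ = ‖iteratedDeriv 2 γ s₁‖) (ψ : ℝ → ℝ)
    (hψ : ∀ t, ψ t =
      ∫ s in {s : ℝ | s ∈ Set.Ioc (s₁ - L / 2) (s₁ + L / 2) ∧ ‖γ s - γ s₁‖ ≤ t},
        ⟪deriv γ s₁, deriv γ s⟫) :
    ((fun t : ℝ => ψ t - (2 * t - κ ^ 2 / 4 * t ^ 3)) =O[𝓝[>] 0] fun t : ℝ => t ^ 5) ∧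
    ((fun t : ℝ => deriv ψ t - (2 - 3 * κ ^ 2 / 4 * t ^ 2)) =O[𝓝[>] 0] fun t : ℝ => t ^ 4) := by
  have hγn : ∀ n : ℕ, ContDiff ℝ n γ := fun n => hγ.of_le (by exact_mod_cast le_top)
  set G : ℝ → EuclideanSpace ℝ (Fin 3) := fun s => γ (s₁ + s) - γ s₁ with hGdef
  have hG : ∀ n : ℕ, ContDiff ℝ n G := fun n =>
    ((hγn n).comp (contDiff_const.add contDiff_id)).sub contDiff_const
  have hdG : ∀ s, deriv G s = deriv γ (s₁ + s) := fun s => by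
    simp only [hGdef, deriv_sub_const]
    exact deriv_comp_const_add _ _ _
  have hd2G : iteratedDeriv 2 G 0 = iteratedDeriv 2 γ s₁ := by
    simp only [iteratedDeriv_succ' (n := 1), funext hdG, iteratedDeriv_comp_const_add, add_zero]
  have harcG : ∀ s, ‖deriv G s‖ = 1 := fun s => by rw [hdG, harc]
  obtain ⟨h, hh, hh0, hGh⟩ := exists_contDiff_eq_smul 5 (hG 6) (by simp [hGdef])
  obtain ⟨σ, hσ, hσ0, hinv, δ, hδ, hmono⟩ :=
    exists_inverse_signed_distance hh (by rw [hh0, harcG])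
  have hF : ContDiffAt ℝ 5 (fun x => ⟪deriv G 0, G (σ x)⟫) 0 :=
    contDiffAt_const.inner ℝ ((hG 5).contDiffAt.comp 0 hσ)
  obtain ⟨hψ₀, hψ₁⟩ := odd_part_isBigO hF (tangential_coordinate_isLittleO (hG 4) harcG hGh
    hh.continuous.continuousAt hh0 hσ.continuousAt hσ0 hinv)
  have hset := sublevel_norm_eventually_eq_Icc (hG 0).continuous (half_pos hL)
    (fun s hs hs0 => sub_ne_zero.2 (ne_of_injOn_Ico_of_periodic hL hper hsimple hs hs0))
    hGh hσ.continuousAt hσ0 hinv hδ hmono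
  have hψeq : ∀ᶠ t in 𝓝[>] 0, ψ t = ⟪deriv G 0, G (σ t)⟫ - ⟪deriv G 0, G (σ (-t))⟫ := by
    filter_upwards [hset] with t ⟨hle, ht⟩
    have hIcc : {s : ℝ | s ∈ Set.Ioc (s₁ - L / 2) (s₁ + L / 2) ∧ ‖γ s - γ s₁‖ ≤ t} =
        Set.Icc (s₁ + σ (-t)) (s₁ + σ t) := by
      ext s
      have hs := Set.ext_iff.1 ht (s - s₁)
      simp only [hGdef, Set.mem_ofPred_eq, Set.mem_Ioc, Set.mem_Icc, add_sub_cancel] at hs ⊢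
      rw [le_sub_iff_add_le', sub_le_iff_le_add', sub_le_iff_le_add', lt_sub_iff_add_lt',
        ← sub_eq_add_neg] at hs
      exact hs
    have hdc : Continuous (deriv γ) := (hγn 1).continuous_deriv le_rfl
    have hγd : ∀ s, HasDerivAt (fun s => ⟪deriv γ s₁, γ s⟫) ⟪deriv γ s₁, deriv γ s⟫ s :=
      fun s => by
        simpa using (hasDerivAt_const s (deriv γ s₁)).inner ℝ
          ((hγn 1).differentiable one_ne_zero s).hasDerivAt
    rw [hψ, hIcc, integral_Icc_eq_integral_Ioc, ← intervalIntegral.integral_of_le (by linarith),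
      intervalIntegral.integral_eq_sub_of_hasDerivAt (fun s _ => hγd s)
        ((continuous_const.inner hdc).intervalIntegrable _ _), ← inner_sub_right, ← inner_sub_right,
      hdG, add_zero]
    simp only [hGdef, sub_sub_sub_cancel_right]
  rw [hκ, ← hd2G]
  refine ⟨(hψ₀.mono nhdsWithin_le_nhds).congr' ?_ .rfl,
    (hψ₁.mono nhdsWithin_le_nhds).congr' ?_ .rfl⟩
  · filter_upwards [hψeq] with t ht
    rw [ht]
    ring
  · filter_upwards [eventually_eventually_nhdsWithin.2 hψeq, self_mem_nhdsWithin] with t ht htpos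
    rw [isOpen_Ioi.nhdsWithin_eq htpos] at ht
    rw [EventuallyEq.deriv_eq ht]
    ring
end

section
/- Let Γ be a smooth simple closed curve of length L. For the two Hadamard-regularized self-inductances H_N(Γ) (from Neumann's integrand (dx₁·dx₂)/|x₁−x₂|) and H_W(Γ) (from Weber's integrand (r̂₁₂·dx₁)(r̂₁₂·dx₂)/|x₁−x₂|), one has H_W(Γ) = H_N(Γ) + (μ₀/2π) L. -/
open MeasureTheory Filter Topology Real

open scoped RealInnerProductSpace

section Curve

theorem ne_of_sub_mem_Ioo {α : Type*} {γ : ℝ → α} {L : ℝ} (hL : 0 < L)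
    (hper : Function.Periodic γ L) (hsimple : Set.InjOn γ (Set.Ico 0 L)) {s t : ℝ}
    (hst : t - s ∈ Set.Ioo 0 L) :
    γ s ≠ γ t := by
  intro h
  have hmod : ∀ x, γ (toIcoMod hL 0 x) = γ x := by
    intro x
    rw [toIcoMod]
    exact hper.sub_zsmul_eq _
  have hmem : ∀ x, toIcoMod hL 0 x ∈ Set.Ico 0 L := by
    intro x
    simpa using toIcoMod_mem_Ico hL 0 x
  have heq := hsimple (hmem s) (hmem t) (by rw [hmod, hmod, h])
  obtain ⟨n, hn⟩ := (toIcoMod_eq_toIcoMod hL).mp heq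
  rw [zsmul_eq_mul] at hn
  rw [hn] at hst
  have h0 : (0 : ℝ) < n := by
    by_contra! hc
    nlinarith [hst.1]
  have h1 : (n : ℝ) < 1 := by
    by_contra! hc
    nlinarith [hst.2]
  have h0' : 0 < n := by exact_mod_cast h0
  have h1' : n < 1 := by exact_mod_cast h1
  lia

variable {E : Type*} [NormedAddCommGroup E] [InnerProductSpace ℝ E]

/-- The Weber integrand minus the Neumann integrand at the parameters `s` and `t`. -/
noncomputable def weberSubNeumann (γ : ℝ → E) (s t : ℝ) : ℝ :=
  (⟪‖γ t - γ s‖⁻¹ • (γ t - γ s), deriv γ s⟫ *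
    ⟪‖γ t - γ s‖⁻¹ • (γ t - γ s), deriv γ t⟫) / ‖γ s - γ t‖ -
    ⟪deriv γ s, deriv γ t⟫ / ‖γ s - γ t‖

theorem periodic_deriv {γ : ℝ → E} {L : ℝ} (hper : Function.Periodic γ L) :
    Function.Periodic (deriv γ) L := fun s => by
  rw [← deriv_comp_add_const, hper.funext]

theorem norm_sub_inner_smul_le {e : E} (he : ‖e‖ = 1) (a : E) (c : ℝ) :
    ‖a - ⟪e, a⟫ • e‖ ≤ ‖a - c • e‖ := by
  refine le_of_sq_le_sq ?_ (norm_nonneg _)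
  rw [norm_sub_sq_real, norm_sub_sq_real, norm_smul, norm_smul, he, inner_smul_right,
    inner_smul_right, real_inner_comm e a]
  simp only [Real.norm_eq_abs, mul_one, sq_abs]
  nlinarith [sq_nonneg (c - ⟪e, a⟫)]

theorem abs_inner_mul_inner_sub_inner_le {d : E} (hd : d ≠ 0) (a b : E) (x y : ℝ) :
    |⟪‖d‖⁻¹ • d, a⟫ * ⟪‖d‖⁻¹ • d, b⟫ - ⟪a, b⟫| ≤ ‖a - x • d‖ * ‖b - y • d‖ := by
  have hd' : ‖d‖ ≠ 0 := norm_ne_zero_iff.mpr hd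
  set e := ‖d‖⁻¹ • d with he_def
  have he : ‖e‖ = 1 := by rw [he_def, norm_smul, norm_inv, norm_norm, inv_mul_cancel₀ hd']
  have hde : d = ‖d‖ • e := by rw [he_def, smul_smul, mul_inv_cancel₀ hd', one_smul]
  have key : ⟪e, a⟫ * ⟪e, b⟫ - ⟪a, b⟫ = -⟪a - ⟪e, a⟫ • e, b - ⟪e, b⟫ • e⟫ := by
    simp only [inner_sub_left, inner_sub_right, inner_smul_left, inner_smul_right,
      real_inner_self_eq_norm_sq, he, real_inner_comm a e]
    simp
  rw [key, abs_neg]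
  refine (abs_real_inner_le_norm _ _).trans ?_
  have h1 := norm_sub_inner_smul_le he a (x * ‖d‖)
  have h2 := norm_sub_inner_smul_le he b (y * ‖d‖)
  rw [mul_smul, ← hde] at h1 h2
  gcongr

theorem norm_sub_sub_smul_deriv_le {γ : ℝ → E} (hγ : Differentiable ℝ γ) {K : ℝ} (hK : 0 ≤ K)
    (hlip : ∀ s t, ‖deriv γ s - deriv γ t‖ ≤ K * |s - t|) (s t : ℝ) :
    ‖γ t - γ s - (t - s) • deriv γ s‖ ≤ K * (t - s) ^ 2 := by
  have hder : ∀ x, HasDerivAt (fun x => γ x - x • deriv γ s) (deriv γ x - deriv γ s) x := by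
    intro x
    have h := (hγ x).hasDerivAt.fun_sub ((hasDerivAt_id x).smul_const (deriv γ s))
    rwa [one_smul] at h
  have h := (convex_uIcc s t).norm_image_sub_le_of_norm_hasDerivWithin_le
    (fun x _ => (hder x).hasDerivWithinAt) (C := K * |t - s|)
    (fun x hx => (hlip x s).trans
      (mul_le_mul_of_nonneg_left (Set.abs_sub_left_of_mem_uIcc hx) hK))
    Set.left_mem_uIcc Set.right_mem_uIcc
  calc ‖γ t - γ s - (t - s) • deriv γ s‖
      = ‖γ t - t • deriv γ s - (γ s - s • deriv γ s)‖ := by congr 1; module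
    _ ≤ K * |t - s| * ‖t - s‖ := h
    _ = K * (t - s) ^ 2 := by rw [Real.norm_eq_abs, mul_assoc, ← sq, sq_abs]

theorem exists_forall_norm_deriv_sub_le {γ : ℝ → E} {L : ℝ} (hL : 0 < L)
    (hγ : ContDiff ℝ (⊤ : ℕ∞) γ) (hper : Function.Periodic γ L) :
    ∃ K, 0 ≤ K ∧ ∀ s t, ‖deriv γ s - deriv γ t‖ ≤ K * |s - t| := by
  have h1 : ContDiff ℝ (⊤ : ℕ∞) (deriv γ) := (contDiff_infty_iff_deriv.mp hγ).2
  have h2 : ContDiff ℝ (⊤ : ℕ∞) (deriv (deriv γ)) := (contDiff_infty_iff_deriv.mp h1).2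
  obtain ⟨K, hK⟩ := isCompact_Icc.exists_bound_of_continuousOn (s := Set.Icc 0 L)
    h2.continuous.continuousOn
  have hper2 : Function.Periodic (deriv (deriv γ)) L := periodic_deriv (periodic_deriv hper)
  have hK' : ∀ x, ‖deriv (deriv γ) x‖ ≤ K := by
    intro x
    obtain ⟨y, hy, hxy⟩ := hper2.exists_mem_Ico₀ hL x
    rw [hxy]
    exact hK y ⟨hy.1, hy.2.le⟩
  refine ⟨K, (norm_nonneg _).trans (hK' 0), fun s t => ?_⟩
  exact convex_univ.norm_image_sub_le_of_norm_deriv_le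
    (fun x _ => (h1.differentiable (by simp)) x) (fun x _ => hK' x) (Set.mem_univ t)
    (Set.mem_univ s)

theorem weberSubNeumann_add_period {γ : ℝ → E} {L : ℝ} (hper : Function.Periodic γ L)
    (s t : ℝ) : weberSubNeumann γ s (t + L) = weberSubNeumann γ s t := by
  simp only [weberSubNeumann, hper t, periodic_deriv hper t]

theorem weberSubNeumann_add_period_left {γ : ℝ → E} {L : ℝ} (hper : Function.Periodic γ L)
    (s t : ℝ) : weberSubNeumann γ (s + L) t = weberSubNeumann γ s t := by
  simp only [weberSubNeumann, hper s, periodic_deriv hper s]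

theorem abs_weberSubNeumann_le_one_div {γ : ℝ → E} (harc : ∀ s, ‖deriv γ s‖ = 1) {s t : ℝ}
    {c : ℝ} (hc : 0 < c) (h : c ≤ ‖γ s - γ t‖) : |weberSubNeumann γ s t| ≤ 1 / c := by
  have hd : γ t - γ s ≠ 0 := by
    rw [← norm_pos_iff, norm_sub_rev]
    exact hc.trans_le h
  have := abs_inner_mul_inner_sub_inner_le hd (deriv γ s) (deriv γ t) 0 0
  rw [weberSubNeumann, ← sub_div, abs_div, abs_norm]
  simp only [zero_smul, sub_zero, harc, mul_one] at this
  exact div_le_div₀ zero_le_one this hc h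

theorem abs_weberSubNeumann_le_of_abs_sub_le {γ : ℝ → E} (hγ : Differentiable ℝ γ)
    (harc : ∀ s, ‖deriv γ s‖ = 1) {K : ℝ} (hK : 0 ≤ K)
    (hlip : ∀ s t, ‖deriv γ s - deriv γ t‖ ≤ K * |s - t|) {s t : ℝ}
    (hst : K * |t - s| ≤ 1 / 2) : |weberSubNeumann γ s t| ≤ K := by
  rcases eq_or_ne s t with rfl | hne
  · simpa [weberSubNeumann] using hK
  have hu : 0 < |t - s| := abs_pos.mpr (sub_ne_zero.mpr hne.symm)
  have hu0 : t - s ≠ 0 := sub_ne_zero.mpr hne.symm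
  have h1 := norm_sub_sub_smul_deriv_le hγ hK hlip s t
  have h2 := norm_sub_sub_smul_deriv_le hγ hK hlip t s
  have hr : |t - s| / 2 ≤ ‖γ s - γ t‖ := by
    have h3 : ‖(t - s) • deriv γ s‖ = |t - s| := by rw [norm_smul, harc, mul_one, Real.norm_eq_abs]
    have h4 := norm_sub_norm_le ((t - s) • deriv γ s) (γ t - γ s)
    rw [norm_sub_rev _ (γ t - γ s), h3, norm_sub_rev (γ t)] at h4
    have h5 : K * (t - s) ^ 2 ≤ |t - s| / 2 := by
      rw [← sq_abs]
      nlinarith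
    linarith
  have hd : γ t - γ s ≠ 0 := by
    rw [← norm_pos_iff, norm_sub_rev]
    linarith
  have key : ∀ v : E, ‖γ t - γ s - (t - s) • v‖ ≤ K * (t - s) ^ 2 →
      ‖v - (t - s)⁻¹ • (γ t - γ s)‖ ≤ K * |t - s| := by
    intro v hv
    have : v - (t - s)⁻¹ • (γ t - γ s) = -((t - s)⁻¹ • (γ t - γ s - (t - s) • v)) := by
      rw [smul_sub _ _ ((t - s) • v), smul_smul, inv_mul_cancel₀ hu0]
      module
    rw [this, norm_neg, norm_smul, norm_inv, Real.norm_eq_abs, inv_mul_le_iff₀ hu]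
    refine hv.trans_eq ?_
    rw [← sq_abs]
    ring
  have ha := key _ h1
  have hb := key (deriv γ t) (by
    have e : γ t - γ s - (t - s) • deriv γ t = -(γ s - γ t - (s - t) • deriv γ t) := by module
    rw [e, norm_neg]
    refine h2.trans_eq ?_
    ring)
  have h := abs_inner_mul_inner_sub_inner_le hd (deriv γ s) (deriv γ t) (t - s)⁻¹ (t - s)⁻¹
  rw [weberSubNeumann, ← sub_div, abs_div, abs_norm, div_le_iff₀ (by linarith)]
  calc _ ≤ _ := h
    _ ≤ (K * |t - s|) * (K * |t - s|) := by gcongr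
    _ ≤ (K * |t - s|) * (1 / 2) := by gcongr
    _ = K * (|t - s| / 2) := by ring
    _ ≤ _ := by gcongr

theorem exists_forall_abs_weberSubNeumann_le {γ : ℝ → E} {L : ℝ} (hL : 0 < L)
    (hγ : ContDiff ℝ (⊤ : ℕ∞) γ) (hper : Function.Periodic γ L) (harc : ∀ s, ‖deriv γ s‖ = 1)
    (hsimple : Set.InjOn γ (Set.Ico 0 L)) : ∃ C, ∀ s t, |weberSubNeumann γ s t| ≤ C := by
  obtain ⟨K, hK, hlip⟩ := exists_forall_norm_deriv_sub_le hL hγ hper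
  have hdiff : Differentiable ℝ γ := hγ.differentiable (by simp)
  obtain ⟨δ, hδ, hKδ⟩ : ∃ δ > 0, K * δ ≤ 1 / 2 := by
    refine ⟨1 / (2 * (K + 1)), by positivity, ?_⟩
    rw [mul_one_div, div_le_div_iff₀ (by positivity) (by positivity)]
    linarith
  have hcont := hγ.continuous
  obtain ⟨c, hc, hcle⟩ : ∃ c > 0, ∀ s ∈ Set.Icc 0 L, ∀ u ∈ Set.Icc δ (L - δ),
      c ≤ ‖γ s - γ (s + u)‖ := by
    obtain ⟨c, hc, h⟩ := (isCompact_Icc.prod isCompact_Icc).exists_forall_le'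
      (s := Set.Icc 0 L ×ˢ Set.Icc δ (L - δ)) (f := fun p : ℝ × ℝ => ‖γ p.1 - γ (p.1 + p.2)‖)
      (a := 0) (by fun_prop) (by
        rintro ⟨s, u⟩ ⟨-, hu⟩
        refine norm_pos_iff.mpr (sub_ne_zero.mpr (ne_of_sub_mem_Ioo hL hper hsimple ?_))
        have h1 : δ ≤ u := hu.1
        have h2 : u ≤ L - δ := hu.2
        constructor <;> dsimp only <;> linarith)
    exact ⟨c, hc, fun s hs u hu => h (s, u) ⟨hs, hu⟩⟩
  have hred : ∀ s ∈ Set.Icc 0 L, ∀ u ∈ Set.Icc 0 L,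
      |weberSubNeumann γ s (s + u)| ≤ max K (1 / c) := by
    intro s hs u hu
    by_cases h1 : u ≤ δ
    · refine le_max_of_le_left (abs_weberSubNeumann_le_of_abs_sub_le hdiff harc hK hlip ?_)
      rw [add_sub_cancel_left, abs_of_nonneg hu.1]
      exact (mul_le_mul_of_nonneg_left h1 hK).trans hKδ
    by_cases h2 : L - δ ≤ u
    · have e : s + u = (s + u - L) + L := by ring
      rw [e, weberSubNeumann_add_period hper]
      refine le_max_of_le_left (abs_weberSubNeumann_le_of_abs_sub_le hdiff harc hK hlip ?_)
      refine (mul_le_mul_of_nonneg_left ?_ hK).trans hKδ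
      rw [abs_le]
      constructor <;> linarith [hu.2]
    · push Not at h1 h2
      exact le_max_of_le_right
        (abs_weberSubNeumann_le_one_div harc hc (hcle s hs u ⟨h1.le, h2.le⟩))
  refine ⟨max K (1 / c), fun s t => ?_⟩
  have hs : Function.Periodic (fun s => weberSubNeumann γ s t) L :=
    fun s => weberSubNeumann_add_period_left hper s t
  obtain ⟨s', hs', hss'⟩ := hs.exists_mem_Ico₀ hL s
  have ht : Function.Periodic (fun t => weberSubNeumann γ s' t) L :=
    fun t => weberSubNeumann_add_period hper s' t
  obtain ⟨t', ht', htt'⟩ := ht.exists_mem_Ico hL t s'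
  rw [hss', htt']
  have := hred s' ⟨hs'.1, hs'.2.le⟩ (t' - s') ⟨by linarith [ht'.1], by linarith [ht'.2]⟩
  rwa [add_sub_cancel] at this

theorem measurable_weberSubNeumann [MeasurableSpace E] [BorelSpace E]
    [SecondCountableTopology E] {γ : ℝ → E} (hγ : ContDiff ℝ (⊤ : ℕ∞) γ) :
    Measurable (fun p : ℝ × ℝ => weberSubNeumann γ p.1 p.2) := by
  have h0 : Measurable γ := hγ.continuous.measurable
  have h1 : Measurable (deriv γ) := (hγ.continuous_deriv (by simp)).measurable
  unfold weberSubNeumann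
  fun_prop

theorem hasDerivAt_neg_inner_normalize {γ : ℝ → E} (hγ : Differentiable ℝ γ) {s t : ℝ}
    (hst : γ s ≠ γ t) :
    HasDerivAt (fun t => -⟪‖γ t - γ s‖⁻¹ • (γ t - γ s), deriv γ s⟫)
      (weberSubNeumann γ s t) t := by
  have hd : γ t - γ s ≠ 0 := sub_ne_zero.mpr hst.symm
  have hd' : ‖γ t - γ s‖ ≠ 0 := norm_ne_zero_iff.mpr hd
  have h1 : HasDerivAt (fun t => γ t - γ s) (deriv γ t) t := (hγ t).hasDerivAt.sub_const _
  have h2 : HasDerivAt (fun t => ‖γ t - γ s‖) (⟪γ t - γ s, deriv γ t⟫ / ‖γ t - γ s‖) t := by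
    have h := (h1.norm_sq).sqrt (by positivity)
    simp only [Real.sqrt_sq (norm_nonneg _)] at h
    convert h using 1
    field_simp
  have h3 := (((h2.fun_inv hd').fun_smul h1).inner ℝ (hasDerivAt_const t (deriv γ s))).neg
  refine h3.congr_deriv ?_
  simp only [weberSubNeumann, inner_zero_right, inner_add_left, inner_smul_left,
    norm_sub_rev (γ s) (γ t), real_inner_comm (deriv γ t) (deriv γ s)]
  simp
  field_simp
  ring

theorem tendsto_inner_normalize_right {γ : ℝ → E} {s : ℝ} (hγ : DifferentiableAt ℝ γ s)
    (harc : ‖deriv γ s‖ = 1) :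
    Tendsto (fun t => -⟪‖γ t - γ s‖⁻¹ • (γ t - γ s), deriv γ s⟫) (𝓝[>] s) (𝓝 (-1)) := by
  have h0 : ‖deriv γ s‖ ≠ 0 := by simp [harc]
  have h1 : Tendsto (slope γ s) (𝓝[>] s) (𝓝 (deriv γ s)) :=
    (hasDerivAt_iff_tendsto_slope.mp hγ.hasDerivAt).mono_left
      (nhdsWithin_mono _ fun x hx => ne_of_gt hx)
  have h2 : Tendsto (fun t => -⟪‖slope γ s t‖⁻¹ • slope γ s t, deriv γ s⟫) (𝓝[>] s)
      (𝓝 (-⟪‖deriv γ s‖⁻¹ • deriv γ s, deriv γ s⟫)) :=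
    (((h1.norm.inv₀ h0).smul h1).inner tendsto_const_nhds).neg
  have e : -⟪‖deriv γ s‖⁻¹ • deriv γ s, deriv γ s⟫ = (-1 : ℝ) := by
    simp [harc]
  rw [e] at h2
  refine h2.congr' ?_
  filter_upwards [self_mem_nhdsWithin] with t ht
  have ht' : 0 < t - s := sub_pos.mpr ht
  rw [slope_def_module, norm_smul, smul_smul, norm_inv, Real.norm_of_nonneg ht'.le]
  congr 3
  field_simp

theorem tendsto_inner_normalize_left {γ : ℝ → E} {s : ℝ} (hγ : DifferentiableAt ℝ γ s)
    (harc : ‖deriv γ s‖ = 1) :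
    Tendsto (fun t => -⟪‖γ t - γ s‖⁻¹ • (γ t - γ s), deriv γ s⟫) (𝓝[<] s) (𝓝 1) := by
  have h0 : ‖deriv γ s‖ ≠ 0 := by simp [harc]
  have h1 : Tendsto (slope γ s) (𝓝[<] s) (𝓝 (deriv γ s)) :=
    (hasDerivAt_iff_tendsto_slope.mp hγ.hasDerivAt).mono_left
      (nhdsWithin_mono _ fun x hx => ne_of_lt hx)
  have h2 : Tendsto (fun t => ⟪‖slope γ s t‖⁻¹ • slope γ s t, deriv γ s⟫) (𝓝[<] s)
      (𝓝 ⟪‖deriv γ s‖⁻¹ • deriv γ s, deriv γ s⟫) :=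
    ((h1.norm.inv₀ h0).smul h1).inner tendsto_const_nhds
  have e : ⟪‖deriv γ s‖⁻¹ • deriv γ s, deriv γ s⟫ = (1 : ℝ) := by
    simp [harc]
  rw [e] at h2
  refine h2.congr' ?_
  filter_upwards [self_mem_nhdsWithin] with t ht
  have ht' : t - s < 0 := sub_neg.mpr ht
  rw [slope_def_module, norm_smul, smul_smul, norm_inv, Real.norm_of_nonpos ht'.le,
    ← inner_neg_left, ← neg_smul]
  congr 2
  have ht0 := ht'.ne
  field_simp

theorem integral_weberSubNeumann {γ : ℝ → E} {L : ℝ} [MeasurableSpace E] [BorelSpace E]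
    [SecondCountableTopology E] (hL : 0 < L)
    (hγ : ContDiff ℝ (⊤ : ℕ∞) γ) (hper : Function.Periodic γ L) (harc : ∀ s, ‖deriv γ s‖ = 1)
    (hsimple : Set.InjOn γ (Set.Ico 0 L)) (s : ℝ) :
    ∫ t in Set.Ioc 0 L, weberSubNeumann γ s t = 2 := by
  have hdiff : Differentiable ℝ γ := hγ.differentiable (by simp)
  obtain ⟨C, hC⟩ := exists_forall_abs_weberSubNeumann_le hL hγ hper harc hsimple
  have hp : Function.Periodic (fun t => weberSubNeumann γ s t) L :=
    fun t => weberSubNeumann_add_period hper s t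
  have hshift := hp.intervalIntegral_add_eq 0 s
  rw [zero_add] at hshift
  rw [← intervalIntegral.integral_of_le hL.le, hshift]
  have hintegrable : IntervalIntegrable (fun t => weberSubNeumann γ s t) volume s (s + L) := by
    rw [intervalIntegrable_iff]
    refine Measure.integrableOn_of_bounded (M := C) (by simp) ?_ ?_
    · exact ((measurable_weberSubNeumann hγ).comp measurable_prodMk_left).aestronglyMeasurable
    · exact Eventually.of_forall fun t => hC s t
  have hb : Tendsto (fun t => -⟪‖γ t - γ s‖⁻¹ • (γ t - γ s), deriv γ s⟫) (𝓝[<] (s + L))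
      (𝓝 1) := by
    have := tendsto_inner_normalize_left (hdiff (s + L)) (harc (s + L))
    simpa only [hper s, periodic_deriv hper s] using this
  rw [intervalIntegral.integral_eq_sub_of_hasDerivAt_of_tendsto (by linarith)
    (fun t ht => hasDerivAt_neg_inner_normalize hdiff
      (ne_of_sub_mem_Ioo hL hper hsimple ⟨by linarith [ht.1], by linarith [ht.2]⟩)) hintegrable
    (tendsto_inner_normalize_right (hdiff s) (harc s)) hb]
  norm_num

theorem tendsto_integral_weberSubNeumann {γ : ℝ → E} {L : ℝ} [MeasurableSpace E] [BorelSpace E]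
    [SecondCountableTopology E] (hL : 0 < L)
    (hγ : ContDiff ℝ (⊤ : ℕ∞) γ) (hper : Function.Periodic γ L) (harc : ∀ s, ‖deriv γ s‖ = 1)
    (hsimple : Set.InjOn γ (Set.Ico 0 L)) :
    Tendsto (fun ε : ℝ =>
      ∫ p in {p : ℝ × ℝ | p ∈ Set.Ioc 0 L ×ˢ Set.Ioc 0 L ∧ ε < ‖γ p.1 - γ p.2‖},
        weberSubNeumann γ p.1 p.2) (𝓝[>] (0 : ℝ)) (𝓝 (2 * L)) := by
  obtain ⟨C, hC⟩ := exists_forall_abs_weberSubNeumann_le hL hγ hper harc hsimple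
  have hmeas := measurable_weberSubNeumann hγ
  have hcont := hγ.continuous
  have hQfin : volume (Set.Ioc 0 L ×ˢ Set.Ioc 0 L : Set (ℝ × ℝ)) ≠ ⊤ := by
    rw [Measure.volume_eq_prod, Measure.prod_prod]
    simp [ENNReal.mul_eq_top]
  have hS : ∀ ε : ℝ, MeasurableSet {p : ℝ × ℝ | ε < ‖γ p.1 - γ p.2‖} := fun ε =>
    (isOpen_lt continuous_const (by fun_prop)).measurableSet
  have htotal : ∫ p in Set.Ioc 0 L ×ˢ Set.Ioc 0 L, weberSubNeumann γ p.1 p.2 = 2 * L := by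
    have hintegrable : IntegrableOn (fun p : ℝ × ℝ => weberSubNeumann γ p.1 p.2)
        (Set.Ioc 0 L ×ˢ Set.Ioc 0 L) (volume.prod volume) :=
      Measure.integrableOn_of_bounded (M := C) hQfin hmeas.aestronglyMeasurable
        (Eventually.of_forall fun p => hC p.1 p.2)
    rw [Measure.volume_eq_prod, setIntegral_prod _ hintegrable]
    simp only [integral_weberSubNeumann hL hγ hper harc hsimple]
    simp [hL.le, mul_comm]
  rw [← htotal]
  have hind : ∀ ε : ℝ,
      ∫ p in {p : ℝ × ℝ | p ∈ Set.Ioc 0 L ×ˢ Set.Ioc 0 L ∧ ε < ‖γ p.1 - γ p.2‖},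
        weberSubNeumann γ p.1 p.2 =
      ∫ p in Set.Ioc 0 L ×ˢ Set.Ioc 0 L, {p : ℝ × ℝ | ε < ‖γ p.1 - γ p.2‖}.indicator
        (fun p => weberSubNeumann γ p.1 p.2) p := fun ε =>
    (setIntegral_indicator (hS ε)).symm
  simp only [hind]
  have : IsFiniteMeasure (volume.restrict (Set.Ioc 0 L ×ˢ Set.Ioc 0 L : Set (ℝ × ℝ))) :=
    isFiniteMeasure_restrict.mpr hQfin
  refine tendsto_integral_filter_of_dominated_convergence (fun _ => C)
    (Eventually.of_forall fun ε => (hmeas.indicator (hS ε)).aestronglyMeasurable)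
    (Eventually.of_forall fun ε => Eventually.of_forall fun p =>
      (norm_indicator_le_norm_self _ p).trans (hC p.1 p.2)) (integrable_const C)
    (Eventually.of_forall fun p => ?_)
  rcases eq_or_ne (γ p.1) (γ p.2) with h | h
  · have h0 : weberSubNeumann γ p.1 p.2 = 0 := by simp [weberSubNeumann, h]
    refine (tendsto_const_nhds (x := weberSubNeumann γ p.1 p.2)).congr fun ε => ?_
    by_cases hp : p ∈ {p : ℝ × ℝ | ε < ‖γ p.1 - γ p.2‖}
    · rw [Set.indicator_of_mem hp]
    · rw [Set.indicator_of_notMem hp, h0]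
  · refine tendsto_const_nhds.congr' ?_
    have hpos : 0 < ‖γ p.1 - γ p.2‖ := norm_pos_iff.mpr (sub_ne_zero.mpr h)
    filter_upwards [Ioo_mem_nhdsGT hpos] with ε hε
    exact (Set.indicator_of_mem (s := {p : ℝ × ℝ | ε < ‖γ p.1 - γ p.2‖}) hε.2
      fun p : ℝ × ℝ => weberSubNeumann γ p.1 p.2).symm

end Curve

/-- The Hadamard-regularized self-inductances of a smooth simple closed curve `Γ` of
length `L` in the sense of Weber and of Neumann differ by `(μ₀/2π) L`:
`H_W(Γ) = H_N(Γ) + (μ₀/2π) L`. -/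
theorem stmt13 (μ₀ L : ℝ) (hμ₀ : 0 < μ₀) (hL : 0 < L)
    (γ : ℝ → EuclideanSpace ℝ (Fin 3)) (hγ : ContDiff ℝ (⊤ : ℕ∞) γ)
    (hper : ∀ s, γ (s + L) = γ s) (harc : ∀ s, ‖deriv γ s‖ = 1)
    (hsimple : Set.InjOn γ (Set.Ico 0 L)) (HN HW : ℝ)
    (hHN : Tendsto (fun ε : ℝ =>
      μ₀ / (4 * π) *
        (∫ p in {p : ℝ × ℝ | p ∈ Set.Ioc 0 L ×ˢ Set.Ioc 0 L ∧ ε < ‖γ p.1 - γ p.2‖},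
          ⟪deriv γ p.1, deriv γ p.2⟫ / ‖γ p.1 - γ p.2‖) +
      μ₀ * L / (2 * π) * Real.log ε) (𝓝[>] (0:ℝ)) (𝓝 HN))
    (hHW : Tendsto (fun ε : ℝ =>
      μ₀ / (4 * π) *
        (∫ p in {p : ℝ × ℝ | p ∈ Set.Ioc 0 L ×ˢ Set.Ioc 0 L ∧ ε < ‖γ p.1 - γ p.2‖},
          (⟪‖γ p.2 - γ p.1‖⁻¹ • (γ p.2 - γ p.1), deriv γ p.1⟫ *
            ⟪‖γ p.2 - γ p.1‖⁻¹ • (γ p.2 - γ p.1), deriv γ p.2⟫) / ‖γ p.1 - γ p.2‖) +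
      μ₀ * L / (2 * π) * Real.log ε) (𝓝[>] (0:ℝ)) (𝓝 HW)) :
    HW = HN + μ₀ / (2 * π) * L := by
  have hper' : Function.Periodic γ L := hper
  have hcont := hγ.continuous
  have hcont' : Continuous (deriv γ) := hγ.continuous_deriv (by simp)
  have hlim := tendsto_integral_weberSubNeumann hL hγ hper' harc hsimple
  have hdiff := hHW.sub hHN
  have hsub : ∀ ε > 0,
      ∫ p in {p : ℝ × ℝ | p ∈ Set.Ioc 0 L ×ˢ Set.Ioc 0 L ∧ ε < ‖γ p.1 - γ p.2‖},
        weberSubNeumann γ p.1 p.2 =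
      (∫ p in {p : ℝ × ℝ | p ∈ Set.Ioc 0 L ×ˢ Set.Ioc 0 L ∧ ε < ‖γ p.1 - γ p.2‖},
          (⟪‖γ p.2 - γ p.1‖⁻¹ • (γ p.2 - γ p.1), deriv γ p.1⟫ *
            ⟪‖γ p.2 - γ p.1‖⁻¹ • (γ p.2 - γ p.1), deriv γ p.2⟫) / ‖γ p.1 - γ p.2‖) -
      ∫ p in {p : ℝ × ℝ | p ∈ Set.Ioc 0 L ×ˢ Set.Ioc 0 L ∧ ε < ‖γ p.1 - γ p.2‖},
          ⟪deriv γ p.1, deriv γ p.2⟫ / ‖γ p.1 - γ p.2‖ := by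
    intro ε hε
    have hSm : MeasurableSet
        {p : ℝ × ℝ | p ∈ Set.Ioc 0 L ×ˢ Set.Ioc 0 L ∧ ε < ‖γ p.1 - γ p.2‖} :=
      (measurableSet_Ioc.prod measurableSet_Ioc).inter
        (isOpen_lt (f := fun _ : ℝ × ℝ => ε) (g := fun p => ‖γ p.1 - γ p.2‖)
          continuous_const (by fun_prop)).measurableSet
    have hfin : volume {p : ℝ × ℝ | p ∈ Set.Ioc 0 L ×ˢ Set.Ioc 0 L ∧ ε < ‖γ p.1 - γ p.2‖}
        ≠ ⊤ := by
      refine measure_ne_top_of_subset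
        (fun p hp => hp.1 : _ ⊆ (Set.Ioc 0 L ×ˢ Set.Ioc 0 L : Set (ℝ × ℝ))) ?_
      rw [Measure.volume_eq_prod, Measure.prod_prod]
      simp [ENNReal.mul_eq_top]
    have hm : Measurable γ := hcont.measurable
    have hm' : Measurable (deriv γ) := hcont'.measurable
    have hmW : Measurable fun p : ℝ × ℝ =>
        (⟪‖γ p.2 - γ p.1‖⁻¹ • (γ p.2 - γ p.1), deriv γ p.1⟫ *
          ⟪‖γ p.2 - γ p.1‖⁻¹ • (γ p.2 - γ p.1), deriv γ p.2⟫) / ‖γ p.1 - γ p.2‖ := by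
      fun_prop
    have hmN : Measurable fun p : ℝ × ℝ =>
        ⟪deriv γ p.1, deriv γ p.2⟫ / ‖γ p.1 - γ p.2‖ := by
      fun_prop
    refine integral_sub (Measure.integrableOn_of_bounded (M := 1 / ε) hfin
      hmW.aestronglyMeasurable ?_)
      (Measure.integrableOn_of_bounded (M := 1 / ε) hfin
      hmN.aestronglyMeasurable ?_)
    · filter_upwards [ae_restrict_mem hSm] with p hp
      rw [norm_div, norm_norm, norm_mul]
      have hunit : ‖‖γ p.2 - γ p.1‖⁻¹ • (γ p.2 - γ p.1)‖ ≤ 1 := by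
        rw [norm_smul, norm_inv, norm_norm]
        exact inv_mul_le_one
      have hle : ∀ s, ‖⟪‖γ p.2 - γ p.1‖⁻¹ • (γ p.2 - γ p.1), deriv γ s⟫‖ ≤ 1 := fun s =>
        (norm_inner_le_norm _ _).trans (by rw [harc, mul_one]; exact hunit)
      exact div_le_div₀ zero_le_one (mul_le_one₀ (hle _) (norm_nonneg _) (hle _)) hε hp.2.le
    · filter_upwards [ae_restrict_mem hSm] with p hp
      rw [norm_div, norm_norm]
      refine div_le_div₀ zero_le_one ((norm_inner_le_norm _ _).trans ?_) hε hp.2.le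
      rw [harc, harc, mul_one]
  have hlim' := (hlim.const_mul (μ₀ / (4 * π)))
  have heq := tendsto_nhds_unique hdiff (hlim'.congr' (by
    filter_upwards [self_mem_nhdsWithin] with ε hε
    rw [hsub ε hε]
    ring))
  have hconst : μ₀ / (4 * π) * (2 * L) = μ₀ / (2 * π) * L := by
    field_simp
    norm_num
  linarith
end
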